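/- arXiv:1304.5618 — 2 statements merged into one kernel-verified Lean document; each statement's English description precedes it below -/
import Mathlib

section
/- No nonzero element D of W_2 satisfies [W_{-1}, D] ⊆ W_1'', i.e., {D ∈ W_2 : [∂_i, D] ∈ W_1'' for all i ∈ {1,…,m+n}} = 0. -/
open Finset

namespace Cartan

/-- Monomial index set for the divided power superalgebra `O(m,n)`:
a multi-exponent `α : Fin m → Fin p` (divided powers truncated at `p-1`)
together with a subset of the odd variables. -/
abbrev Mon (p m n : ℕ) := (Fin m → Fin p) × Finset (Fin n)

/-- The divided power superalgebra `O(m,n)` realized as coefficient functions on monomials. -/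
abbrev O (F : Type*) [Field F] (p m n : ℕ) := Mon p m n → F

/-- The Witt superalgebra `W(m,n)` realized as tuples of coefficients:
`D : W` represents `∑ i, D i · ∂ i`. -/
abbrev W (F : Type*) [Field F] (p m n : ℕ) := Fin (m + n) → O F p m n

variable {F : Type*} [Field F] {p m n : ℕ}

/-- `ℤ₂`-parity of a monomial. -/
def parMon (μ : Mon p m n) : ZMod 2 := (μ.2.card : ZMod 2)

/-- `ℤ`-degree of a monomial (each variable has degree 1). -/
def zdMon (μ : Mon p m n) : ℕ := (∑ i, (μ.1 i : ℕ)) + μ.2.card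

/-- Parity of the index `i`: even if `i < m`, odd otherwise. -/
def parIdx (m : ℕ) {k : ℕ} (i : Fin k) : ZMod 2 := if (i : ℕ) < m then 0 else 1

/-- The constant function `1 ∈ O(m,n)`. -/
def oneO (F : Type*) [Field F] (p m n : ℕ) [NeZero p] : O F p m n :=
  fun μ => if μ.1 = 0 ∧ μ.2 = (∅ : Finset (Fin n)) then 1 else 0

/-- Koszul sign for multiplying exterior monomials `x^s · x^t`. -/
def extSign {n : ℕ} (s t : Finset (Fin n)) : ℤ :=
  (-1) ^ ∑ i ∈ t, (s.filter fun j => i < j).card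

/-- Multiplication of the divided power superalgebra `O(m,n)`:
`x^(α)x^u · x^(β)x^v = (Koszul sign) · ∏ binom(α+β,α) · x^(α+β) x^(u∪v)`. -/
def mulO [NeZero p] (f g : O F p m n) : O F p m n := fun μ =>
  ∑ ν : Mon p m n, ∑ κ : Mon p m n,
    if (∀ i, (ν.1 i : ℕ) + (κ.1 i : ℕ) = (μ.1 i : ℕ)) ∧ ν.2 ∩ κ.2 = ∅ ∧ ν.2 ∪ κ.2 = μ.2 then
      ((extSign ν.2 κ.2 : ℤ) : F) * (∏ i, (((μ.1 i : ℕ).choose (ν.1 i : ℕ) : ℕ) : F))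
        * f ν * g κ
    else 0

/-- The even partial superderivation `∂_i`, `i ≤ m`, on `O(m,n)`. -/
def dEv [NeZero p] (i : Fin m) (f : O F p m n) : O F p m n := fun μ =>
  if h : (μ.1 i : ℕ) + 1 < p then f (Function.update μ.1 i ⟨(μ.1 i : ℕ) + 1, h⟩, μ.2) else 0

/-- The odd partial superderivation `∂_{m+i}` on `O(m,n)`. -/
def dOd (i : Fin n) (f : O F p m n) : O F p m n := fun μ =>
  if i ∈ μ.2 then 0
  else ((-1 : F)) ^ (μ.2.filter fun j => j < i).card * f (μ.1, insert i μ.2)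

/-- The partial superderivation `∂_i`, `i ∈ I = {1,…,m+n}`. -/
def pd [NeZero p] (i : Fin (m + n)) (f : O F p m n) : O F p m n :=
  Sum.elim (fun j => dEv j f) (fun j => dOd j f) (finSumFinEquiv.symm i)

/-- The variable `x_i` as an element of `O(m,n)`. -/
def xVar [NeZero p] (i : Fin (m + n)) : O F p m n := fun μ =>
  if h : (i : ℕ) < m then
    (if μ.1 = Pi.single (⟨i, h⟩ : Fin m) 1 ∧ μ.2 = (∅ : Finset (Fin n)) then 1 else 0)
  else
    (if μ.1 = 0 ∧ μ.2 = {(⟨(i : ℕ) - m, by have := i.isLt; omega⟩ : Fin n)} then 1 else 0)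

/-- Projection of `f ∈ O(m,n)` onto its parity-`b` component. -/
def projO (b : ZMod 2) (f : O F p m n) : O F p m n :=
  fun μ => if parMon μ = b then f μ else 0

/-- Projection of `D ∈ W(m,n)` onto its parity-`b` component
(the parity of `f ∂_i` is `|f| + |∂_i|`). -/
def projW (b : ZMod 2) (D : W F p m n) : W F p m n :=
  fun i => projO (b + parIdx m i) (D i)

/-- `f` is `ℤ₂`-homogeneous of parity `b`. -/
def isParO (b : ZMod 2) (f : O F p m n) : Prop := ∀ μ, f μ ≠ 0 → parMon μ = b

/-- `D` is `ℤ₂`-homogeneous of parity `b`. -/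
def isParW (b : ZMod 2) (D : W F p m n) : Prop := ∀ i, isParO (b + parIdx m i) (D i)

/-- Action of a superderivation `D = ∑ f_i ∂_i` on `g ∈ O(m,n)`: `D(g) = ∑ f_i · ∂_i(g)`. -/
def act [NeZero p] (D : W F p m n) (g : O F p m n) : O F p m n :=
  ∑ i, mulO (D i) (pd i g)

/-- Super-commutator bracket on `W(m,n)`, extended bilinearly from homogeneous components:
`[D,E] = D∘E - (-1)^{|D||E|} E∘D`, recorded via values on the generators `x_k`. -/
def bracketW [NeZero p] (D E : W F p m n) : W F p m n :=
  ∑ a : ZMod 2, ∑ b : ZMod 2,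
    (fun k => act (projW a D) (projW b E k)
      - ((-1 : F)) ^ (a * b).val • act (projW b E) (projW a D k) : W F p m n)

/-- Divergence: `div(f ∂_i) = (-1)^{|f||∂_i|} ∂_i(f)`, extended linearly. -/
def divW [NeZero p] (D : W F p m n) : O F p m n :=
  ∑ i, ∑ b : ZMod 2, ((-1 : F)) ^ (b * parIdx m i).val • pd i (projO b (D i))

/-- The Euler (degree) derivation `𝔇 = ∑ x_k ∂_k`. -/
def euler (F : Type*) [Field F] (p m n : ℕ) [NeZero p] : W F p m n := fun i => xVar i

/-- The derivation `f𝔇 = ∑ (f·x_k) ∂_k`. -/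
def fEuler [NeZero p] (f : O F p m n) : W F p m n := fun i => mulO f (xVar i)

/-- `f` is `ℤ`-homogeneous of degree `s` (i.e. `f ∈ O_s`). -/
def inO (s : ℤ) (f : O F p m n) : Prop := ∀ μ, f μ ≠ 0 → (zdMon μ : ℤ) = s

/-- `D ∈ W_s` for the standard grading (`zd(f∂_i) = zd(f) - 1`). -/
def inW (s : ℤ) (D : W F p m n) : Prop := ∀ i, inO (s + 1) (D i)

/-- The superderivation `∂_i` as an element of `W(m,n)`. -/
def delOp (F : Type*) [Field F] (p m n : ℕ) [NeZero p] (i : Fin (m + n)) : W F p m n :=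
  fun k => if k = i then oneO F p m n else 0

/-- The `ℤ`-graded component `W_s` as a submodule. -/
def Wgrade (F : Type*) [Field F] (p m n : ℕ) (s : ℤ) : Submodule F (W F p m n) where
  carrier := {D | inW s D}
  add_mem' := by
    intro a b ha hb i μ h
    by_cases h1 : a i μ = 0
    · exact hb i μ (by simpa [h1] using h)
    · exact ha i μ h1
  zero_mem' := by intro i μ h; simp at h
  smul_mem' := by
    intro c a ha i μ h
    refine ha i μ (fun h1 => h ?_)
    simp [h1]


/-- The monomial `μ` is divisible by the variable `i`. -/
def hasV (i : Fin m ⊕ Fin n) (μ : Mon p m n) : Prop :=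
  Sum.elim (fun j => (μ.1 j : ℕ) ≠ 0) (fun j => j ∈ μ.2) i

/-- `ρ` is the monomial `μ` times the variable `i`. -/
def IsRaise (i : Fin m ⊕ Fin n) (μ ρ : Mon p m n) : Prop :=
  Sum.elim
    (fun j => (ρ.1 j : ℕ) = μ.1 j + 1 ∧ (∀ l, l ≠ j → ρ.1 l = μ.1 l) ∧ ρ.2 = μ.2)
    (fun j => j ∉ μ.2 ∧ ρ.1 = μ.1 ∧ ρ.2 = insert j μ.2) i

theorem pd_raise [NeZero p] (i : Fin m ⊕ Fin n) (f : O F p m n) (μ ρ : Mon p m n)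
    (h : IsRaise i μ ρ) :
    pd (finSumFinEquiv i) f μ = 0 ↔ f ρ = 0 := by
  rcases i with j | j
  · obtain ⟨h1, h2, h3⟩ := h
    have hlt : (μ.1 j : ℕ) + 1 < p := by rw [← h1]; exact (ρ.1 j).isLt
    have : ρ = (Function.update μ.1 j ⟨(μ.1 j : ℕ) + 1, hlt⟩, μ.2) := by
      refine Prod.ext ?_ h3
      funext l
      by_cases hl : l = j
      · subst hl; simp; exact Fin.ext h1
      · simp [hl, h2 l hl]
    simp only [pd, Equiv.symm_apply_apply, Sum.elim_inl, dEv, hlt, dif_pos, this]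
  · obtain ⟨h1, h2, h3⟩ := h
    have : ρ = (μ.1, insert j μ.2) := Prod.ext h2 h3
    simp [pd, dOd, h1, this]

theorem pd_no_raise [NeZero p] (i : Fin m ⊕ Fin n) (f : O F p m n) (μ : Mon p m n)
    (h : ∀ ρ, ¬ IsRaise i μ ρ) : pd (finSumFinEquiv i) f μ = 0 := by
  rcases i with j | j
  · simp only [pd, Equiv.symm_apply_apply, Sum.elim_inl, dEv]
    split_ifs with hlt
    · exfalso
      refine h (Function.update μ.1 j ⟨(μ.1 j : ℕ) + 1, hlt⟩, μ.2) ⟨by simp, ?_, rfl⟩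
      intro l hl; simp [hl]
    · rfl
  · simp only [pd, Equiv.symm_apply_apply, Sum.elim_inr, dOd]
    split_ifs with hlt
    · rfl
    · exact absurd ⟨hlt, rfl, rfl⟩ (h (μ.1, insert j μ.2))

theorem exists_raise (hp : 1 < p) (i : Fin m ⊕ Fin n) (μ : Mon p m n) (h : ¬ hasV i μ) :
    ∃ ρ, IsRaise i μ ρ := by
  rcases i with j | j
  · simp [hasV] at h
    refine ⟨(Function.update μ.1 j ⟨(μ.1 j : ℕ) + 1, ?_⟩, μ.2), by simp, ?_, rfl⟩
    · rw [h]; simpa using hp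
    · intro l hl; simp [hl]
  · exact ⟨(μ.1, insert j μ.2), h, rfl, rfl⟩

theorem exists_lower (i : Fin m ⊕ Fin n) (μ : Mon p m n) (h : hasV i μ) :
    ∃ ν, IsRaise i ν μ := by
  rcases i with j | j
  · simp only [hasV, Sum.elim_inl] at h
    refine ⟨(Function.update μ.1 j ⟨(μ.1 j : ℕ) - 1, ?_⟩, μ.2), ?_, ?_, rfl⟩
    · have := (μ.1 j).isLt; omega
    · simp; omega
    · intro l hl; simp [hl]
  · refine ⟨(μ.1, μ.2.erase j), by simp, rfl, ?_⟩
    simp only [hasV, Sum.elim_inr] at h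
    simp [Finset.insert_erase h]

/-- Raising by two different variables commutes. -/
theorem raise_comm (i k : Fin m ⊕ Fin n) (hik : i ≠ k) (ν ρ τ : Mon p m n)
    (h1 : IsRaise k ν ρ) (h2 : IsRaise i ρ τ) (hk : ¬ hasV k ν) :
    ∃ σ, IsRaise k σ τ ∧ ¬ hasV k σ := by
  have hτ : hasV k τ := by
    rcases i with i | i <;> rcases k with k | k <;> simp [IsRaise, hasV] at *
    · intro h0
      rw [h2.2.1 k (Ne.symm hik)] at h0
      omega
    · rw [h2.2.2, h1.2.2]; simp
    · rw [h2.2.1]; omega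
    · rw [h2.2.2, h1.2.2]; simp
  obtain ⟨σ, hσ⟩ := exists_lower k τ hτ
  refine ⟨σ, hσ, ?_⟩
  rcases i with i | i <;> rcases k with k | k <;> simp [IsRaise, hasV] at *
  · have := h2.2.1 k (Ne.symm hik)
    rw [this] at hσ
    omega
  · exact hσ.1
  · rw [h2.2.1] at hσ
    omega
  · exact hσ.1

theorem xVar_ne_zero [NeZero p] (hp : 1 < p) (k : Fin m ⊕ Fin n) (κ : Mon p m n)
    (h : xVar (F := F) (finSumFinEquiv k) κ ≠ 0) : IsRaise k ((fun _ => 0), ∅) κ := by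
  have : Fact (1 < p) := ⟨hp⟩
  rcases k with k | k
  · replace h : κ.1 = Pi.single k 1 ∧ κ.2 = ∅ := by
      by_contra hc
      exact h (by simp [xVar, hc])
    refine ⟨?_, ?_, h.2⟩
    · rw [h.1]; simp [Fin.val_one', Nat.mod_eq_of_lt hp]
    · intro l hl; rw [h.1]; simp [hl]
  · simp [xVar] at h
    exact ⟨by simp, h.1, by simpa using h.2⟩

theorem xVar_raise [NeZero p] (hp : 1 < p) (k : Fin m ⊕ Fin n) (κ : Mon p m n)
    (h : IsRaise k ((fun _ => 0), ∅) κ) : xVar (F := F) (finSumFinEquiv k) κ = 1 := by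
  rcases k with k | k
  · obtain ⟨h1, h2, h3⟩ := h
    have : κ.1 = Pi.single k 1 := by
      funext l
      by_cases hl : l = k
      · subst hl; apply Fin.ext; rw [h1]; simp [Fin.val_one', Nat.mod_eq_of_lt hp]
      · simp [hl, h2 l hl]
    simp at h3
    simp [xVar, this, h3]
  · obtain ⟨h1, h2, h3⟩ := h
    have h2' : κ.1 = 0 := h2
    simp [xVar, h2', h3]

theorem raise_unique (k : Fin m ⊕ Fin n) (ν ρ σ : Mon p m n)
    (h1 : IsRaise k ν ρ) (h2 : IsRaise k ν σ) : ρ = σ := by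
  rcases k with k | k
  · obtain ⟨a1, a2, a3⟩ := h1
    obtain ⟨b1, b2, b3⟩ := h2
    refine Prod.ext (funext fun l => ?_) (a3.trans b3.symm)
    by_cases hl : l = k
    · subst hl; exact Fin.ext (a1.trans b1.symm)
    · rw [a2 l hl, b2 l hl]
  · exact Prod.ext (h1.2.1.trans h2.2.1.symm) (h1.2.2.trans h2.2.2.symm)

theorem mul_x_no [NeZero p] (hp : 1 < p) (k : Fin m ⊕ Fin n) (g : O F p m n) (μ : Mon p m n)
    (h : ¬ hasV k μ) : mulO g (xVar (finSumFinEquiv k)) μ = 0 := by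
  unfold mulO
  refine Finset.sum_eq_zero fun ν _ => Finset.sum_eq_zero fun κ _ => ?_
  split_ifs with hc
  · by_cases hx : xVar (F := F) (finSumFinEquiv k) κ = 0
    · simp [hx]
    · exfalso
      have := xVar_ne_zero hp k κ hx
      apply h
      rcases k with k | k
      · have h1 := this.1
        have h2 := hc.1 k
        show (μ.1 k : ℕ) ≠ 0
        omega
      · have h1 := this.2.2
        simp [hasV, ← hc.2.2, h1]
  · rfl

theorem mul_x_raise [NeZero p] (hp : 1 < p) (k : Fin m ⊕ Fin n) (g : O F p m n)
    (ν ρ : Mon p m n) (h : ¬ hasV k ν) (hr : IsRaise k ν ρ)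
    (h0 : mulO g (xVar (finSumFinEquiv k)) ρ = 0) : g ν = 0 := by
  obtain ⟨κ, hκ⟩ := exists_raise hp k (((fun _ => ⟨0, by omega⟩), ∅) : Mon p m n)
    (by rcases k with k | k <;> simp [hasV])
  have hz : (⟨0, by omega⟩ : Fin p) = 0 := by apply Fin.ext; simp
  rw [hz] at hκ
  unfold mulO at h0
  rw [Finset.sum_eq_single ν, Finset.sum_eq_single κ] at h0
  · rw [xVar_raise hp k κ hκ, if_pos] at h0
    · have hprod : (∏ i, (((ρ.1 i : ℕ).choose (ν.1 i : ℕ) : ℕ) : F)) = 1 := by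
        refine Finset.prod_eq_one fun l _ => ?_
        rcases k with k | k
        · by_cases hl : l = k
          · subst hl
            simp [hasV] at h
            simp [h]
          · rw [hr.2.1 l hl]; simp
        · rw [hr.2.1]; simp
      rw [hprod] at h0
      simpa [extSign] using h0
    · rcases k with k | k
      · obtain ⟨h1, h2, h3⟩ := hκ
        obtain ⟨r1, r2, r3⟩ := hr
        refine ⟨fun l => ?_, ?_, ?_⟩
        · by_cases hl : l = k
          · subst hl; rw [h1, r1]; simp
          · rw [h2 l hl, r2 l hl]; simp
        · rw [h3]; simp
        · rw [h3, r3]; simp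
      · obtain ⟨h1, h2, h3⟩ := hκ
        obtain ⟨r1, r2, r3⟩ := hr
        refine ⟨fun l => ?_, ?_, ?_⟩
        · rw [h2, r2]; simp
        · rw [h3]; simp [r1]
        · rw [h3, r3]; ext; simp [or_comm]
  · intro κ' _ hne
    split_ifs with hc
    · by_cases hx : xVar (F := F) (finSumFinEquiv k) κ' = 0
      · simp [hx]
      · exact absurd (raise_unique k _ _ _ (xVar_ne_zero hp k κ' hx) hκ) hne
    · rfl
  · simp
  · intro ν' _ hne
    refine Finset.sum_eq_zero fun κ' _ => ?_
    split_ifs with hc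
    · by_cases hx : xVar (F := F) (finSumFinEquiv k) κ' = 0
      · simp [hx]
      · exfalso
        have hx' := xVar_ne_zero hp k κ' hx
        apply hne
        rcases k with k | k
        · obtain ⟨h1, h2, h3⟩ := hx'
          obtain ⟨r1, r2, r3⟩ := hr
          refine Prod.ext ?_ ?_
          · funext l
            apply Fin.ext
            have := hc.1 l
            by_cases hl : l = k
            · subst hl; simp at h1; omega
            · rw [h2 l hl, r2 l hl] at this; simpa using this
          · have := hc.2.2
            rw [h3, r3] at this
            simpa using this
        · obtain ⟨h1, h2, h3⟩ := hx'
          obtain ⟨r1, r2, r3⟩ := hr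
          refine Prod.ext ?_ ?_
          · funext l
            apply Fin.ext
            have := hc.1 l
            rw [h2, r2] at this; simpa using this
          · have e1 := hc.2.2
            have e2 := hc.2.1
            rw [h3] at e1 e2
            rw [r3] at e1
            have hk : k ∉ ν'.2 := by
              intro hk
              have : k ∈ ν'.2 ∩ insert k ∅ := by simp [hk]
              rw [e2] at this; simp at this
            ext l
            have := Finset.ext_iff.1 e1 l
            by_cases hl : l = k
            · subst hl; simp [hk, r1]
            · simpa [hl] using this
    · rfl
  · simp

theorem one_mulO [NeZero p] (f : O F p m n) : mulO (oneO F p m n) f = f := by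
  funext μ
  unfold mulO
  rw [Finset.sum_eq_single ((0 : Fin m → Fin p), ∅), Finset.sum_eq_single μ]
  · simp [extSign, oneO]
  · intro κ _ hne
    rw [if_neg]
    rintro ⟨h1, -, h3⟩
    apply hne
    refine Prod.ext (funext fun l => Fin.ext ?_) ?_
    · simpa using h1 l
    · simpa using h3
  · simp
  · intro ν _ hne
    refine Finset.sum_eq_zero fun κ _ => ?_
    have : oneO F p m n ν = 0 := by
      simp only [oneO]
      rw [if_neg]
      rintro ⟨h1, h2⟩
      exact hne (Prod.ext h1 h2)
    simp [this]
  · simp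

theorem zero_mulO [NeZero p] (f : O F p m n) : mulO 0 f = 0 := by
  funext μ; simp [mulO]

theorem mulO_zero [NeZero p] (f : O F p m n) : mulO f 0 = 0 := by
  funext μ; simp [mulO]

theorem pd_add [NeZero p] (i : Fin (m + n)) (f g : O F p m n) :
    pd i (f + g) = pd i f + pd i g := by
  obtain ⟨i, rfl⟩ := finSumFinEquiv.surjective i
  funext μ
  rcases i with j | j
  · simp only [pd, Equiv.symm_apply_apply, Sum.elim_inl, dEv, Pi.add_apply]
    split_ifs <;> simp
  · simp only [pd, Equiv.symm_apply_apply, Sum.elim_inr, dOd, Pi.add_apply]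
    split_ifs <;> simp [mul_add]

theorem pd_const [NeZero p] (i : Fin (m + n)) (f : O F p m n)
    (hf : ∀ μ, f μ ≠ 0 → μ.1 = 0 ∧ μ.2 = ∅) : pd i f = 0 := by
  obtain ⟨i, rfl⟩ := finSumFinEquiv.surjective i
  funext μ
  by_cases h : ∃ ρ, IsRaise i μ ρ
  · obtain ⟨ρ, hρ⟩ := h
    rw [Pi.zero_apply, pd_raise i f μ ρ hρ]
    by_contra hne
    obtain ⟨h1, h2⟩ := hf ρ hne
    rcases i with j | j
    · have := hρ.1
      rw [h1] at this
      simp at this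
    · have := hρ.2.2
      rw [h2] at this
      exact absurd this.symm (Finset.insert_ne_empty _ _)
  · exact pd_no_raise i f μ (fun ρ hρ => h ⟨ρ, hρ⟩)

theorem projW_delOp [NeZero p] (a : ZMod 2) (i k : Fin (m + n)) :
    projW a (delOp F p m n i) k
      = if k = i ∧ a = parIdx m i then oneO F p m n else 0 := by
  funext μ
  have hz : ∀ x y : ZMod 2, (0 = x + y) ↔ x = y := by decide
  by_cases hk : k = i
  · subst hk
    simp only [projW, projO, delOp, if_true, true_and]
    by_cases hμ : μ.1 = 0 ∧ μ.2 = ∅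
    · have : parMon μ = 0 := by simp [parMon, hμ.2]
      rw [this]
      simp only [hz]
      split_ifs <;> rfl
    · have : oneO F p m n μ = 0 := by simp only [oneO]; rw [if_neg hμ]
      split_ifs <;> simp [this]
  · simp [projW, projO, delOp, hk]

theorem act_delOp [NeZero p] (a : ZMod 2) (i : Fin (m + n)) (f : O F p m n) :
    act (projW a (delOp F p m n i)) f = if a = parIdx m i then pd i f else 0 := by
  unfold act
  rw [Finset.sum_eq_single i]
  · rw [projW_delOp]
    split_ifs with h1 h2 h2
    · exact one_mulO _
    · exact absurd h1.2 h2
    · exact absurd ⟨rfl, h2⟩ h1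
    · exact zero_mulO _
  · intro k _ hk
    rw [projW_delOp, if_neg (by simp [hk]), zero_mulO]
  · simp

theorem act_const [NeZero p] (a : ZMod 2) (i k : Fin (m + n)) (E : W F p m n) :
    act E (projW a (delOp F p m n i) k) = 0 := by
  unfold act
  refine Finset.sum_eq_zero fun j _ => ?_
  rw [pd_const, mulO_zero]
  intro μ hμ
  rw [projW_delOp] at hμ
  split_ifs at hμ
  · by_contra hne
    exact hμ (by simp only [oneO]; rw [if_neg hne])
  · simp at hμ

theorem bracket_delOp [NeZero p] (i k : Fin (m + n)) (D : W F p m n) :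
    bracketW (delOp F p m n i) D k = pd i (D k) := by
  have hsum : projW 0 D k + projW 1 D k = D k := by
    funext μ
    have : ∀ x y : ZMod 2, (x = 0 + y ∧ x ≠ 1 + y) ∨ (x ≠ 0 + y ∧ x = 1 + y) := by decide
    rcases this (parMon μ) (parIdx m k) with ⟨h1, h2⟩ | ⟨h1, h2⟩
    · simp only [projW, projO, Pi.add_apply, if_pos h1, if_neg h2, add_zero]
    · simp only [projW, projO, Pi.add_apply]
      rw [if_neg h1, if_pos h2, zero_add]
  have hu : ∀ f : ZMod 2 → O F p m n, ∑ a : ZMod 2, f a = f 0 + f 1 := fun f =>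
    Fin.sum_univ_two f
  simp only [bracketW, Finset.sum_apply, act_const, smul_zero, sub_zero, act_delOp]
  rw [Finset.sum_comm]
  simp only [Finset.sum_ite_eq', Finset.sum_ite_eq, Finset.mem_univ, if_true]
  rw [hu, ← pd_add, hsum]

theorem exists_k (hm : 2 ≤ m) (hn : 2 ≤ n) (i : Fin m ⊕ Fin n) (ν : Mon p m n)
    (h : zdMon ν = 1) : ∃ k, i ≠ k ∧ ¬ hasV k ν := by
  unfold zdMon at h
  rcases i with i | i
  · by_contra! hc
    have h0 : (⟨0, by omega⟩ : Fin n) ∈ ν.2 := hc (Sum.inr _) (by simp)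
    have h1 : (⟨1, by omega⟩ : Fin n) ∈ ν.2 := hc (Sum.inr _) (by simp)
    have := Finset.card_le_one.1 (by omega : ν.2.card ≤ 1) _ h0 _ h1
    simp at this
  · by_contra! hc
    have h0 : (ν.1 ⟨0, by omega⟩ : ℕ) ≠ 0 := hc (Sum.inl _) (by simp)
    have h1 : (ν.1 ⟨1, by omega⟩ : ℕ) ≠ 0 := hc (Sum.inl _) (by simp)
    have := Finset.add_le_sum (f := fun l => (ν.1 l : ℕ)) (s := Finset.univ)
      (fun _ _ => Nat.zero_le _) (Finset.mem_univ (⟨0, by omega⟩ : Fin m))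
      (Finset.mem_univ (⟨1, by omega⟩ : Fin m)) (by simp)
    omega


/-- `{D ∈ W_2 : [∂_i, D] ∈ W_1'' for all i} = 0`. -/
theorem W2_pulled_into_Wpp (F : Type*) [Field F] (p m n : ℕ) [Fact p.Prime] [CharP F p]
    (hp : 3 < p) (hm : 2 ≤ m) (hn : 2 ≤ n) (D : W F p m n) (hD : inW 2 D)
    (h : ∀ i : Fin (m + n), ∃ g : O F p m n, inO 1 g ∧
      bracketW (delOp F p m n i) D = fEuler g) :
    D = 0 := by
  have hp1 : 1 < p := by omega
  choose g hg hb using h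
  have H : ∀ i k : Fin (m + n), pd i (D k) = mulO (g i) (xVar k) := by
    intro i k
    rw [← bracket_delOp, hb]
    rfl
  have hg0 : ∀ i ν, g i ν = 0 := by
    intro i ν
    by_contra hne
    have hdeg : zdMon ν = 1 := by exact_mod_cast hg i ν hne
    obtain ⟨i, rfl⟩ := finSumFinEquiv.surjective i
    obtain ⟨k, hik, hk⟩ := exists_k hm hn i ν hdeg
    obtain ⟨ρ, hρ⟩ := exists_raise hp1 k ν hk
    apply hne
    refine mul_x_raise hp1 k _ ν ρ hk hρ ?_
    rw [← H]
    by_cases hr : ∃ τ, IsRaise i ρ τ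
    · obtain ⟨τ, hτ⟩ := hr
      rw [pd_raise i _ ρ τ hτ]
      obtain ⟨σ, hσ, hkσ⟩ := raise_comm i k hik ν ρ τ hρ hτ hk
      rw [← pd_raise k _ σ τ hσ, H]
      exact mul_x_no hp1 k _ σ hkσ
    · exact pd_no_raise i _ ρ (fun τ hτ => hr ⟨τ, hτ⟩)
  funext k μ
  by_contra hne
  have hdeg : zdMon μ = 3 := by exact_mod_cast hD k μ hne
  have hex : ∃ i, hasV i μ := by
    by_contra! hc
    have h1 : ∀ j, (μ.1 j : ℕ) = 0 := fun j => not_not.1 (hc (Sum.inl j))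
    have h2 : μ.2 = ∅ := Finset.eq_empty_of_forall_notMem fun j => hc (Sum.inr j)
    simp only [zdMon, h1, h2] at hdeg
    simp at hdeg
  obtain ⟨i, hi⟩ := hex
  obtain ⟨ν, hν⟩ := exists_lower i μ hi
  apply hne
  rw [Pi.zero_apply, Pi.zero_apply, ← pd_raise i _ ν μ hν, H]
  have : g (finSumFinEquiv i) = 0 := funext fun ν => hg0 _ ν
  rw [this, zero_mulO]
  rfl

end Cartan
end

section
/- For any i ∈ {1,…,m+n} and any even invertible (m+n)×(m+n) matrix A over F, defining new coordinates ξ = x·A^{−1} and the induced algebra automorphism φ of O(m,n) with φ(x_i) = ξ_i, the map Φ(D) = φ∘D∘φ^{−1} is a ℤ-homogeneous Lie superalgebra automorphism of W(m,n) satisfying div(Φ(D)) = φ(div D) for all D ∈ W(m,n); consequently Φ restricts to an automorphism of S(m,n). -/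
open Finset

namespace Cartan

variable {F : Type*} [Field F] {p m n : ℕ}

/-- The derivation `D_{ij}(a)` for `a` of parity `c`. -/
def Dij [NeZero p] (i j : Fin (m + n)) (c : ZMod 2) (a : O F p m n) : W F p m n := fun k =>
  (if k = j then ((-1 : F)) ^ (parIdx m i * parIdx m j).val • pd i a else 0)
    - (if k = i then ((-1 : F)) ^ ((parIdx m i + parIdx m j) * c).val • pd j a else 0)

/-- The spanning set of the special superalgebra `S(m,n)`:
all `D_{ij}(a)` with `a` `ℤ₂`-homogeneous. -/
def SSet (F : Type*) [Field F] (p m n : ℕ) [NeZero p] : Set (W F p m n) :=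
  {D | ∃ (i j : Fin (m + n)) (c : ZMod 2) (a : O F p m n), isParO c a ∧ D = Dij i j c a}

/-- The map `Φ(D) = φ ∘ D ∘ φ⁻¹` induced on `W(m,n)` by an automorphism `φ` of
`O(m,n)`, recorded through the values of the derivation on the generators `x_k`. -/
def PhiMap [NeZero p] (φ : O F p m n ≃ₗ[F] O F p m n) (D : W F p m n) : W F p m n :=
  fun k => φ (act D (φ.symm (xVar k)))

section Helpers

/-- Multiplication as a bilinear map. -/
def mulL (F : Type*) [Field F] (p m n : ℕ) [NeZero p] :
    O F p m n →ₗ[F] O F p m n →ₗ[F] O F p m n :=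
  LinearMap.mk₂ F mulO
    (by
      intro f f' g; funext μ
      simp only [mulO, Pi.add_apply, ← Finset.sum_add_distrib]
      refine Finset.sum_congr rfl fun ν _ => Finset.sum_congr rfl fun κ _ => ?_
      split_ifs <;> ring)
    (by
      intro c f g; funext μ
      simp only [mulO, Pi.smul_apply, smul_eq_mul, Finset.mul_sum]
      refine Finset.sum_congr rfl fun ν _ => Finset.sum_congr rfl fun κ _ => ?_
      split_ifs <;> ring)
    (by
      intro f g g'; funext μ
      simp only [mulO, Pi.add_apply, ← Finset.sum_add_distrib]
      refine Finset.sum_congr rfl fun ν _ => Finset.sum_congr rfl fun κ _ => ?_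
      split_ifs <;> ring)
    (by
      intro c f g; funext μ
      simp only [mulO, Pi.smul_apply, smul_eq_mul, Finset.mul_sum]
      refine Finset.sum_congr rfl fun ν _ => Finset.sum_congr rfl fun κ _ => ?_
      split_ifs <;> ring)

lemma mulO_eq [NeZero p] (f g : O F p m n) : mulO f g = mulL F p m n f g := rfl

lemma pd_castAdd [NeZero p] (a : Fin m) (f : O F p m n) : pd (Fin.castAdd n a) f = dEv a f := by
  simp [pd]

lemma pd_natAdd [NeZero p] (a : Fin n) (f : O F p m n) : pd (Fin.natAdd m a) f = dOd a f := by
  simp [pd]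

/-- Partial derivative as a linear map. -/
def pdL (F : Type*) [Field F] (p m n : ℕ) [NeZero p] (i : Fin (m + n)) :
    O F p m n →ₗ[F] O F p m n where
  toFun := pd i
  map_add' f g := by
    refine Fin.addCases (fun a => ?_) (fun a => ?_) i
    · simp only [pd_castAdd]; funext μ; simp only [dEv, Pi.add_apply]; split_ifs <;> simp
    · simp only [pd_natAdd]; funext μ; simp only [dOd, Pi.add_apply]; split_ifs <;> ring
  map_smul' c f := by
    refine Fin.addCases (fun a => ?_) (fun a => ?_) i
    · simp only [pd_castAdd]; funext μ; simp only [dEv, Pi.smul_apply]; split_ifs <;> simp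
    · simp only [pd_natAdd]; funext μ
      simp only [dOd, Pi.smul_apply, smul_eq_mul, RingHom.id_apply]; split_ifs <;> ring

lemma pd_eq [NeZero p] (i : Fin (m + n)) (f : O F p m n) : pd i f = pdL F p m n i f := rfl

/-- Parity projection as a linear map. -/
def projL (F : Type*) [Field F] (p m n : ℕ) (b : ZMod 2) : O F p m n →ₗ[F] O F p m n where
  toFun := projO b
  map_add' f g := by funext μ; simp only [projO, Pi.add_apply]; split_ifs <;> simp
  map_smul' c f := by funext μ; simp only [projO, Pi.smul_apply]; split_ifs <;> simp

lemma proj_eq (b : ZMod 2) (f : O F p m n) : projO b f = projL F p m n b f := rfl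

/-- Degree projection as a linear map. -/
def degL (F : Type*) [Field F] (p m n : ℕ) (s : ℤ) : O F p m n →ₗ[F] O F p m n where
  toFun f μ := if (zdMon μ : ℤ) = s then f μ else 0
  map_add' f g := by funext μ; simp only [Pi.add_apply]; split_ifs <;> simp
  map_smul' c f := by funext μ; simp only [Pi.smul_apply]; split_ifs <;> simp

lemma degL_apply (s : ℤ) (f : O F p m n) (μ : Mon p m n) :
    degL F p m n s f μ = if (zdMon μ : ℤ) = s then f μ else 0 := rfl

lemma inO_iff (s : ℤ) (f : O F p m n) : inO s f ↔ degL F p m n s f = f := by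
  constructor
  · intro h; funext μ; rw [degL_apply]
    split_ifs with h1
    · rfl
    · by_contra h2; exact h1 (h μ (Ne.symm h2))
  · intro h μ h1
    by_contra h2; apply h1; rw [← h, degL_apply, if_neg h2]

lemma isParO_iff (s : ZMod 2) (f : O F p m n) : isParO s f ↔ projL F p m n s f = f := by
  constructor
  · intro h; funext μ; rw [← proj_eq, projO]
    split_ifs with h1
    · rfl
    · by_contra h2; exact h1 (h μ (Ne.symm h2))
  · intro h μ h1
    by_contra h2; apply h1; rw [← h, ← proj_eq, projO, if_neg h2]

lemma mulO_single [NeZero p] (ν : Mon p m n) (g : O F p m n) (μ : Mon p m n) :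
    mulO (Pi.single ν 1) g μ = ∑ κ : Mon p m n,
      if (∀ i, (ν.1 i : ℕ) + (κ.1 i : ℕ) = (μ.1 i : ℕ)) ∧ ν.2 ∩ κ.2 = ∅ ∧ ν.2 ∪ κ.2 = μ.2 then
      ((extSign ν.2 κ.2 : ℤ) : F) * (∏ i, (((μ.1 i : ℕ).choose (ν.1 i : ℕ) : ℕ) : F)) * g κ
    else 0 := by
  rw [mulO, Finset.sum_eq_single ν]
  · simp
  · intro b _ hb
    simp [Pi.single_eq_of_ne hb]
  · simp

lemma oneO_eq [NeZero p] : oneO F p m n = Pi.single (0, ∅) 1 := by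
  funext μ
  simp only [oneO, Pi.single_apply, Prod.ext_iff]

lemma mulO_one [NeZero p] (f : O F p m n) : mulO f (oneO F p m n) = f := by
  funext μ
  rw [mulO, Finset.sum_eq_single μ]
  · rw [Finset.sum_eq_single ((0, ∅) : Mon p m n)]
    · simp [oneO, extSign]
    · intro b _ hb
      rw [oneO_eq, Pi.single_eq_of_ne hb]; simp
    · simp
  · intro ν _ hν
    apply Finset.sum_eq_zero
    intro κ _
    split_ifs with h
    · rw [oneO_eq]
      by_cases hκ : κ = (0, ∅)
      · exfalso; subst hκ; apply hν
        refine Prod.ext (funext fun i => Fin.ext (by simpa using h.1 i)) (by simpa using h.2.2)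
      · rw [Pi.single_eq_of_ne hκ]; simp
    · rfl
  · simp

lemma xVar_castAdd [NeZero p] (a : Fin m) :
    (xVar (Fin.castAdd n a) : O F p m n) = Pi.single (Pi.single a 1, ∅) 1 := by
  funext μ
  simp [xVar, Pi.single_apply, Prod.ext_iff]

lemma xVar_natAdd [NeZero p] (a : Fin n) :
    (xVar (Fin.natAdd m a) : O F p m n) = Pi.single (0, {a}) 1 := by
  funext μ
  simp [xVar, Pi.single_apply, Prod.ext_iff]

/-- Replace one exponent by `k`. -/
def upd (μ : Mon p m n) (a : Fin m) (k : ℕ) (hk : k < p) : Mon p m n :=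
  (Function.update μ.1 a ⟨k, hk⟩, μ.2)

lemma mul_x_ev [NeZero p] (hp : 1 < p) (a : Fin m) (g : O F p m n) (μ : Mon p m n) :
    mulO (xVar (Fin.castAdd n a)) g μ =
      ((μ.1 a : ℕ) : F) * g (upd μ a ((μ.1 a : ℕ) - 1) (by omega)) := by
  have h1 : ((1 : Fin p) : ℕ) = 1 := by
    rw [Fin.val_one', Nat.mod_eq_of_lt hp]
  have hs : ∀ i, ((Pi.single a (1 : Fin p) : Fin m → Fin p) i : ℕ) = if i = a then 1 else 0 := by
    intro i
    by_cases h : i = a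
    · subst h; rw [Pi.single_eq_same, h1, if_pos rfl]
    · simp [h]
  rw [xVar_castAdd, mulO_single]
  have hprod : (∏ i, (((μ.1 i : ℕ).choose ((Pi.single a (1 : Fin p) : Fin m → Fin p) i : ℕ) : ℕ) : F))
      = ((μ.1 a : ℕ) : F) := by
    rw [Finset.prod_eq_single a]
    · rw [hs]; simp
    · intro b _ hb; rw [hs, if_neg hb]; simp
    · simp
  simp only [hprod]
  rw [Finset.sum_eq_single (upd μ a ((μ.1 a : ℕ) - 1) (by omega))]
  · by_cases h0 : (μ.1 a : ℕ) = 0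
    · simp [h0]
    · rw [if_pos]
      · simp [extSign]
      · refine ⟨fun i => ?_, by simp, by simp [upd]⟩
        rw [hs]
        by_cases h : i = a
        · subst h; simp [upd]; omega
        · simp [upd, h]
  · intro κ _ hκ
    rw [if_neg]
    rintro ⟨h2, -, h3⟩
    apply hκ
    refine Prod.ext (funext fun i => Fin.ext ?_) (by simpa [upd] using h3)
    have := h2 i
    rw [hs] at this
    by_cases h : i = a
    · subst h; simp [upd] at *; omega
    · simp [upd, h] at *; omega
  · simp

lemma mul_x_od [NeZero p] (a : Fin n) (g : O F p m n) (μ : Mon p m n) :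
    mulO (xVar (Fin.natAdd m a)) g μ =
      if a ∈ μ.2 then (-1 : F) ^ (μ.2.filter fun j => j < a).card * g (μ.1, μ.2.erase a) else 0 := by
  rw [xVar_natAdd, mulO_single]
  rw [Finset.sum_eq_single ((μ.1, μ.2.erase a) : Mon p m n)]
  · by_cases h : a ∈ μ.2
    · rw [if_pos h, if_pos]
      · have : (∑ i ∈ μ.2.erase a, (({a} : Finset (Fin n)).filter fun j => i < j).card)
            = (μ.2.filter fun j => j < a).card := by
          rw [Finset.card_filter, ← Finset.add_sum_erase _ _ h]
          simp only [lt_irrefl, if_false, zero_add]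
          refine Finset.sum_congr rfl fun i _ => ?_
          rw [Finset.card_filter, Finset.sum_singleton]
        simp [extSign, this]
      · refine ⟨by simp, by simp, ?_⟩
        ext i; by_cases hi : i = a <;> simp [hi, h]
    · rw [if_neg h, if_neg]
      rintro ⟨-, -, h3⟩
      apply h; rw [← h3]; simp
  · intro κ _ hκ
    rw [if_neg]
    rintro ⟨h1, h2, h3⟩
    apply hκ
    refine Prod.ext (funext fun i => Fin.ext (by simpa using h1 i)) ?_
    change κ.2 = μ.2.erase a
    rw [← h3]
    have : a ∉ κ.2 := by
      intro h
      have : a ∈ ({a} : Finset (Fin n)) ∩ κ.2 := by simp [h]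
      rw [h2] at this; simp at this
    ext i; by_cases hi : i = a <;> simp [hi, this]
  · simp

lemma parIdx_castAdd (a : Fin m) : parIdx m (Fin.castAdd n a) = 0 := by simp [parIdx]
lemma parIdx_natAdd (a : Fin n) : parIdx m (Fin.natAdd m a) = 1 := by simp [parIdx]

lemma pd_one [NeZero p] (i : Fin (m + n)) : pd i (oneO F p m n) = 0 := by
  refine Fin.addCases (fun a => ?_) (fun a => ?_) i
  · rw [pd_castAdd]; funext μ
    simp only [dEv, oneO]
    split_ifs with h1 h2
    · exfalso
      have := congrArg Fin.val (congrFun h2.1 a)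
      simp at this
    · rfl
    · rfl
  · rw [pd_natAdd]; funext μ
    simp [dOd, oneO]

lemma dEv_apply [NeZero p] (a : Fin m) (f : O F p m n) (μ : Mon p m n) :
    dEv a f μ = if h : (μ.1 a : ℕ) + 1 < p then f (upd μ a ((μ.1 a : ℕ) + 1) h) else 0 := rfl

lemma pd_mul_x [NeZero p] [CharP F p] (hp : 1 < p) (i j : Fin (m + n)) (g : O F p m n) :
    pd j (mulO (xVar i) g) = (if j = i then g else 0)
      + (-1 : F) ^ (parIdx m i * parIdx m j).val • mulO (xVar i) (pd j g) := by
  refine Fin.addCases (fun a => ?_) (fun a => ?_) i <;>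
  refine Fin.addCases (fun b => ?_) (fun b => ?_) j <;> funext μ
  · simp only [pd_castAdd, parIdx_castAdd, Pi.add_apply, Pi.smul_apply, mul_x_ev hp, dEv_apply]
    by_cases hab : b = a
    · subst hab
      have e : ∀ k h, upd (upd μ b k h) b (μ.1 b : ℕ) (μ.1 b).2 = μ := by
        intro k h
        simp [upd]
      by_cases h : (μ.1 b : ℕ) + 1 < p
      · by_cases h0 : (μ.1 b : ℕ) = 0
        · have e0 : Function.update μ.1 b 0 = μ.1 := by
            funext i; apply Fin.ext
            by_cases hi : i = b
            · subst hi; simp [h0]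
            · simp [hi]
          simp [upd, h0, e0, hp]
        · have : (μ.1 b : ℕ) - 1 + 1 = (μ.1 b : ℕ) := by omega
          simp [h, upd, this]; ring
      · have h3 : (μ.1 b : ℕ) + 1 = p := by have := (μ.1 b).2; omega
        have h4 : ((μ.1 b : ℕ) : F) + 1 = 0 := by
          have := CharP.cast_eq_zero F p
          rw [← h3] at this; simpa using this
        have : (μ.1 b : ℕ) - 1 + 1 = (μ.1 b : ℕ) := by omega
        simp [h, upd, this]
        linear_combination (-g μ) * h4
    · have hab' : a ≠ b := Ne.symm hab
      by_cases h : (μ.1 b : ℕ) + 1 < p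
      · simp [h, hab, hab', upd]
        left; rw [Function.update_comm hab]
      · simp [h, hab, hab', upd]
  · have hne : Fin.natAdd m b ≠ Fin.castAdd n a := by
      intro h; have := congrArg Fin.val h; simp at this; omega
    simp only [pd_natAdd, parIdx_castAdd, Pi.add_apply, Pi.smul_apply, mul_x_ev hp, dOd, if_neg hne]
    simp only [upd]
    by_cases hb : b ∈ μ.2
    · simp [hb]
    · simp [hb]; ring
  · have hne : Fin.castAdd n b ≠ Fin.natAdd m a := by
      intro h; have := congrArg Fin.val h; simp at this; omega
    simp only [pd_castAdd, parIdx_castAdd, Pi.add_apply, Pi.smul_apply, mul_x_od, dEv, if_neg hne]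
    split_ifs <;> simp
  · simp only [pd_natAdd, parIdx_natAdd, Pi.add_apply, Pi.smul_apply, mul_x_od, dOd]
    have sq : ∀ k : ℕ, (-1 : F) ^ k * (-1) ^ k = 1 := by
      intro k; rw [← mul_pow]; simp
    by_cases hab : b = a
    · subst hab
      by_cases h : b ∈ μ.2
      · simp only [h, if_true, Finset.mem_erase, ne_eq, not_true, false_and, if_false]
        have : (μ.2.erase b).filter (fun j => j < b) = μ.2.filter fun j => j < b := by
          ext j; simp only [Finset.mem_filter, Finset.mem_erase]
          constructor
          · tauto
          · intro hj; exact ⟨⟨ne_of_lt hj.2, hj.1⟩, hj.2⟩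
        rw [this, Finset.insert_erase h, ← mul_assoc, sq]
        simp [ZMod.val_one]
      · simp only [h, if_true, if_false, Finset.mem_insert_self]
        have : (insert b μ.2).filter (fun j => j < b) = μ.2.filter fun j => j < b := by
          ext j; simp only [Finset.mem_filter, Finset.mem_insert]
          constructor
          · rintro ⟨rfl | h1, h2⟩
            · exact absurd h2 (lt_irrefl _)
            · exact ⟨h1, h2⟩
          · tauto
        rw [this, Finset.erase_insert h, ← mul_assoc, sq]
        simp
    · have hab' : a ≠ b := Ne.symm hab
      have hne : Fin.natAdd m b ≠ Fin.natAdd m a := by simpa using hab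
      rw [if_neg hne]
      by_cases h : b ∈ μ.2
      · simp [h, hab]
      · by_cases h' : a ∈ μ.2
        · simp only [h, h', if_true, if_false, Finset.mem_insert, Finset.mem_erase, hab', false_or,
            and_false]
          rw [Finset.erase_insert_of_ne hab, Finset.filter_insert, Finset.filter_erase]
          rcases lt_or_gt_of_ne hab with hlt | hlt
          · have hm : a ∉ μ.2.filter (fun j => j < b) := by simp [hlt.le]
            rw [if_pos hlt, Finset.card_insert_of_notMem (by simp [h]),
              Finset.erase_eq_of_notMem hm]
            simp [ZMod.val_one]; ring
          · have hm : a ∈ μ.2.filter (fun j => j < b) := by simp [h', hlt]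
            rw [if_neg (not_lt.2 hlt.le), ← Finset.card_erase_add_one hm]
            simp [ZMod.val_one]; ring
        · simp [h, h', hab']

lemma pd_x [NeZero p] [CharP F p] (hp : 1 < p) (i j : Fin (m + n)) :
    pd j (xVar i : O F p m n) = if j = i then oneO F p m n else 0 := by
  have := pd_mul_x (F := F) (p := p) hp i j (oneO F p m n)
  rw [mulO_one, pd_one, mulO_eq, map_zero, smul_zero, add_zero] at this
  exact this

lemma zd_upd (μ : Mon p m n) (a : Fin m) (h : (μ.1 a : ℕ) ≠ 0) :
    zdMon (upd μ a ((μ.1 a : ℕ) - 1) (by omega)) + 1 = zdMon μ := by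
  unfold zdMon upd
  rw [← Finset.add_sum_erase _ _ (Finset.mem_univ a),
    ← Finset.add_sum_erase _ (fun i => (μ.1 i : ℕ)) (Finset.mem_univ a)]
  have : ∑ x ∈ univ.erase a, ((Function.update μ.1 a ⟨(μ.1 a : ℕ) - 1, by omega⟩ x : Fin p) : ℕ)
      = ∑ x ∈ univ.erase a, (μ.1 x : ℕ) := by
    refine Finset.sum_congr rfl fun x hx => ?_
    rw [Function.update_of_ne (Finset.ne_of_mem_erase hx)]
  simp only [this, Function.update_self]
  omega

lemma zd_erase (μ : Mon p m n) (a : Fin n) (h : a ∈ μ.2) :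
    zdMon ((μ.1, μ.2.erase a) : Mon p m n) + 1 = zdMon μ := by
  unfold zdMon
  have := Finset.card_erase_add_one h
  simp only; omega

lemma par_erase (μ : Mon p m n) (a : Fin n) (h : a ∈ μ.2) :
    parMon ((μ.1, μ.2.erase a) : Mon p m n) + 1 = parMon μ := by
  unfold parMon
  rw [← Finset.card_erase_add_one h]; simp

lemma proj_mul_x [NeZero p] (hp : 1 < p) (b : ZMod 2) (i : Fin (m + n)) (g : O F p m n) :
    projO b (mulO (xVar i) g) = mulO (xVar i) (projO (b + parIdx m i) g) := by
  refine Fin.addCases (fun a => ?_) (fun a => ?_) i <;> funext μ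
  · simp only [projO, mul_x_ev hp, parIdx_castAdd, add_zero]
    have : parMon (upd μ a ((μ.1 a : ℕ) - 1) (by omega)) = parMon μ := rfl
    simp [this]
  · simp only [projO, mul_x_od, parIdx_natAdd]
    by_cases h : a ∈ μ.2
    · have h2 := par_erase μ a h
      have h3 : (parMon ((μ.1, μ.2.erase a) : Mon p m n) = b + 1) ↔ parMon μ = b := by
        rw [← h2]; generalize parMon ((μ.1, μ.2.erase a) : Mon p m n) = c
        revert c b; decide
      simp [h, h3]
    · simp [h]

lemma deg_mul_x [NeZero p] (hp : 1 < p) (s : ℤ) (i : Fin (m + n)) (g : O F p m n) :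
    degL F p m n s (mulO (xVar i) g) = mulO (xVar i) (degL F p m n (s - 1) g) := by
  refine Fin.addCases (fun a => ?_) (fun a => ?_) i <;> funext μ
  · simp only [degL_apply, mul_x_ev hp]
    by_cases h : (μ.1 a : ℕ) = 0
    · simp [h]
    · have h2 := zd_upd μ a h
      have h3 : ((zdMon (upd μ a ((μ.1 a : ℕ) - 1) (by omega)) : ℕ) : ℤ) = s - 1
          ↔ ((zdMon μ : ℕ) : ℤ) = s := by
        rw [← h2]; push_cast; omega
      simp [h3]
  · simp only [degL_apply, mul_x_od]
    by_cases h : a ∈ μ.2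
    · have h2 := zd_erase μ a h
      have h3 : ((zdMon ((μ.1, μ.2.erase a) : Mon p m n) : ℕ) : ℤ) = s - 1
          ↔ ((zdMon μ : ℕ) : ℤ) = s := by
        rw [← h2]; push_cast; omega
      simp [h, h3]
    · simp [h]

lemma proj_one [NeZero p] (b : ZMod 2) :
    projO b (oneO F p m n) = if b = 0 then oneO F p m n else 0 := by
  funext μ
  simp only [projO, oneO]
  by_cases h : μ.1 = 0 ∧ μ.2 = ∅
  · have : parMon μ = 0 := by simp [parMon, h.2]
    rw [this]
    by_cases hb : b = 0
    · simp [hb, oneO]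
    · simp [hb, Ne.symm hb]
  · by_cases hb : b = 0 <;> simp [h, hb, oneO]

lemma deg_one [NeZero p] (s : ℤ) :
    degL F p m n s (oneO F p m n) = if s = 0 then oneO F p m n else 0 := by
  funext μ
  simp only [degL_apply, oneO]
  by_cases h : μ.1 = 0 ∧ μ.2 = ∅
  · have : zdMon μ = 0 := by simp [zdMon, h.1, h.2]
    rw [this]
    by_cases hb : s = 0
    · simp [hb, oneO]
    · have : (0 : ℤ) ≠ s := Ne.symm hb
      simp [hb, this]
  · by_cases hb : s = 0 <;> simp [h, hb, oneO]

/-- Induction principle: `O(m,n)` is generated by the variables. -/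
lemma gen_induction [NeZero p] [CharP F p] (hp : 1 < p) (P : Submodule F (O F p m n))
    (h1 : oneO F p m n ∈ P) (hx : ∀ i g, g ∈ P → mulO (xVar i) g ∈ P) (f : O F p m n) :
    f ∈ P := by
  have key : ∀ (N : ℕ) (μ : Mon p m n), zdMon μ = N → Pi.single μ (1 : F) ∈ P := by
    intro N
    induction N with
    | zero =>
      intro μ hμ
      have h2 : μ = (0, ∅) := by
        simp only [zdMon, Nat.add_eq_zero_iff, Finset.sum_eq_zero_iff, Finset.card_eq_zero] at hμ
        refine Prod.ext (funext fun i => Fin.ext (by simpa using hμ.1 i (Finset.mem_univ i))) hμ.2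
      rw [h2, ← oneO_eq]; exact h1
    | succ N ih =>
      intro μ hμ
      by_cases h : ∃ a, (μ.1 a : ℕ) ≠ 0
      · obtain ⟨a, ha⟩ := h
        have h2 := zd_upd μ a ha
        have h3 := hx (Fin.castAdd n a) _ (ih _ (by omega :
          zdMon (upd μ a ((μ.1 a : ℕ) - 1) (by omega)) = N))
        have hc : ((μ.1 a : ℕ) : F) ≠ 0 := by
          rw [Ne, CharP.cast_eq_zero_iff F p]
          intro hd
          exact absurd (Nat.le_of_dvd (by omega) hd) (by have := (μ.1 a).2; omega)
        convert P.smul_mem (((μ.1 a : ℕ) : F)⁻¹) h3 using 1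
        funext κ
        rw [Pi.smul_apply, mul_x_ev hp]
        by_cases hκ : κ = μ
        · subst hκ; simp [hc]
        · rw [Pi.single_eq_of_ne hκ]
          by_cases h0 : (κ.1 a : ℕ) = 0
          · simp [h0]
          · rw [Pi.single_eq_of_ne]
            · simp
            · intro he; apply hκ
              have e1 := congrArg Prod.fst he
              have e2 := congrArg Prod.snd he
              refine Prod.ext (funext fun i => Fin.ext ?_) e2
              have := congrArg Fin.val (congrFun e1 i)
              by_cases hi : i = a
              · subst hi; simp [upd] at this; omega
              · simpa [upd, hi] using this
      · push Not at h
        have hne : μ.2.Nonempty := by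
          rw [← Finset.card_pos]
          have : zdMon μ = μ.2.card := by simp [zdMon, h]
          omega
        obtain ⟨a, ha⟩ := hne
        have h2 := zd_erase μ a ha
        have h3 := hx (Fin.natAdd m a) _ (ih _ (by omega :
          zdMon ((μ.1, μ.2.erase a) : Mon p m n) = N))
        convert P.smul_mem ((-1 : F) ^ (μ.2.filter fun j => j < a).card) h3 using 1
        funext κ
        rw [Pi.smul_apply, mul_x_od]
        by_cases hκ : κ = μ
        · subst hκ
          simp only [ha, if_true, Pi.single_eq_same, smul_eq_mul, mul_one]
          rw [← mul_pow]; simp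
        · rw [Pi.single_eq_of_ne hκ]
          by_cases h0 : a ∈ κ.2
          · rw [Pi.single_eq_of_ne]
            · simp
            · intro he; apply hκ
              have e1 := congrArg Prod.fst he
              have e2 := congrArg Prod.snd he
              refine Prod.ext e1 ?_
              rw [← Finset.insert_erase h0, ← Finset.insert_erase ha]
              exact congrArg _ e2
          · simp [h0]
  have : f = ∑ μ, f μ • (Pi.single μ (1 : F) : O F p m n) := by
    funext κ
    simp [Finset.sum_apply, Pi.single_apply]
  rw [this]
  exact P.sum_mem fun μ _ => P.smul_mem _ (key _ μ rfl)

end Helpers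

section Main

variable [Fact p.Prime] [CharP F p]

/-- The standing data: an even invertible coordinate change `φ`. -/
structure Dat (A : Matrix (Fin (m + n)) (Fin (m + n)) F) (φ : O F p m n ≃ₗ[F] O F p m n) :
    Prop where
  hp : 1 < p
  hA : IsUnit A.det
  even : ∀ i j : Fin (m + n), parIdx m i ≠ parIdx m j → A i j = 0
  evenInv : ∀ i j : Fin (m + n), parIdx m i ≠ parIdx m j → A⁻¹ i j = 0
  mul : ∀ f g : O F p m n, φ (mulO f g) = mulO (φ f) (φ g)
  one : φ (oneO F p m n) = oneO F p m n
  x : ∀ i : Fin (m + n), φ (xVar i) = ∑ j : Fin (m + n), A⁻¹ j i • xVar j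

variable {A : Matrix (Fin (m + n)) (Fin (m + n)) F} {φ : O F p m n ≃ₗ[F] O F p m n}

/-- The inverse of an even matrix is even. -/
lemma even_inv (hA : IsUnit A.det)
    (heven : ∀ i j : Fin (m + n), parIdx m i ≠ parIdx m j → A i j = 0)
    (i j : Fin (m + n)) (hij : parIdx m i ≠ parIdx m j) : A⁻¹ i j = 0 := by
  -- the projection of the inverse to its block-diagonal part is a right inverse of `A`
  let B : Matrix (Fin (m + n)) (Fin (m + n)) F :=
    fun i j => if parIdx m i = parIdx m j then A⁻¹ i j else 0
  have hB : A * B = 1 := by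
    ext i j
    rw [Matrix.mul_apply]
    by_cases h : parIdx m i = parIdx m j
    · rw [← Matrix.mul_nonsing_inv A hA, Matrix.mul_apply]
      refine Finset.sum_congr rfl fun k _ => ?_
      by_cases hk : parIdx m k = parIdx m j
      · simp [B, hk]
      · rw [heven i k (fun h' => hk (h'.symm.trans h))]; simp
    · rw [Matrix.one_apply_ne (fun h' => h (by rw [h']))]
      refine Finset.sum_eq_zero fun k _ => ?_
      by_cases hk : parIdx m k = parIdx m j
      · rw [heven i k (fun h' => h (h'.trans hk))]; simp
      · simp [B, hk]
  rw [Matrix.inv_eq_right_inv hB]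
  simp [B, hij]

lemma Dat.mul_x (d : Dat A φ) (i : Fin (m + n)) (g : O F p m n) :
    φ (mulO (xVar i) g) = ∑ j, A⁻¹ j i • mulO (xVar j) (φ g) := by
  rw [d.mul, d.x, mulO_eq]
  simp only [map_sum, map_smul, LinearMap.sum_apply, LinearMap.smul_apply, mulO_eq]

lemma Dat.pd (d : Dat A φ) (i : Fin (m + n)) (g : O F p m n) :
    φ (pd i g) = ∑ k, A i k • Cartan.pd k (φ g) := by
  let T : Fin (m + n) → O F p m n →ₗ[F] O F p m n := fun i =>
    φ.toLinearMap ∘ₗ pdL F p m n i - ∑ k, A i k • (pdL F p m n k ∘ₗ φ.toLinearMap)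
  have hT : ∀ i g, g ∈ LinearMap.ker (T i) ↔ φ (Cartan.pd i g) = ∑ k, A i k • Cartan.pd k (φ g) := by
    intro i g
    simp [T, LinearMap.mem_ker, sub_eq_zero, pd_eq]
  have main := gen_induction (F := F) d.hp (⨅ i, LinearMap.ker (T i)) ?_ ?_ g
  · rw [Submodule.mem_iInf] at main
    exact (hT i g).1 (main i)
  · rw [Submodule.mem_iInf]
    intro i; rw [hT, d.one]; simp [pd_one]
  · intro l g hg
    rw [Submodule.mem_iInf] at hg ⊢
    intro i
    have hgi := (hT i g).1 (hg i)
    rw [hT, pd_mul_x d.hp, d.mul_x, map_add, map_smul, d.mul_x, hgi]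
    have e1 : ∀ k, A i k • Cartan.pd k (∑ j, A⁻¹ j l • mulO (xVar j) (φ g))
        = (A i k * A⁻¹ k l) • φ g + (-1 : F) ^ (parIdx m l * parIdx m i).val •
          ∑ j, A⁻¹ j l • A i k • mulO (xVar j) (Cartan.pd k (φ g)) := by
      intro k
      by_cases hk : parIdx m i = parIdx m k
      · rw [pd_eq, map_sum]
        simp only [map_smul, ← pd_eq, pd_mul_x d.hp, smul_add, Finset.sum_add_distrib]
        congr 1
        · simp [smul_smul]
        · rw [Finset.smul_sum, Finset.smul_sum]
          refine Finset.sum_congr rfl fun j _ => ?_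
          by_cases hj : parIdx m j = parIdx m l
          · rw [hj, hk, smul_smul, smul_smul, smul_smul, smul_smul]; congr 1; ring
          · rw [d.evenInv j l hj]; simp
      · rw [d.even i k hk]; simp
    simp only [e1, Finset.sum_add_distrib, ← Finset.sum_smul]
    rw [← Matrix.mul_apply, Matrix.mul_nonsing_inv A d.hA, ← Finset.smul_sum]
    congr 1
    · by_cases h : i = l
      · subst h; simp
      · simp [h, Matrix.one_apply_ne h]
    · congr 1
      rw [Finset.sum_comm]
      refine Finset.sum_congr rfl fun j _ => ?_
      rw [mulO_eq, map_sum, Finset.smul_sum]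
      simp only [map_smul, mulO_eq]

lemma Dat.proj (d : Dat A φ) (b : ZMod 2) (g : O F p m n) :
    projO b (φ g) = φ (projO b g) := by
  let T : ZMod 2 → O F p m n →ₗ[F] O F p m n := fun b =>
    φ.toLinearMap ∘ₗ projL F p m n b - projL F p m n b ∘ₗ φ.toLinearMap
  have hT : ∀ b g, g ∈ LinearMap.ker (T b) ↔ projO b (φ g) = φ (projO b g) := by
    intro b g
    simp [T, LinearMap.mem_ker, sub_eq_zero, proj_eq]; exact eq_comm
  have main := gen_induction (F := F) d.hp (⨅ b, LinearMap.ker (T b)) ?_ ?_ g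
  · rw [Submodule.mem_iInf] at main
    exact (hT b g).1 (main b)
  · rw [Submodule.mem_iInf]
    intro b; rw [hT, d.one, proj_one]
    split_ifs
    · rw [d.one]
    · simp
  · intro l g hg
    rw [Submodule.mem_iInf] at hg ⊢
    intro b
    rw [hT, proj_mul_x d.hp, d.mul_x, d.mul_x, proj_eq, map_sum]
    refine Finset.sum_congr rfl fun j _ => ?_
    by_cases hj : parIdx m j = parIdx m l
    · rw [map_smul, ← proj_eq, proj_mul_x d.hp, hj, (hT _ g).1 (hg _)]
    · rw [d.evenInv j l hj]; simp

lemma Dat.deg (d : Dat A φ) (s : ℤ) (g : O F p m n) :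
    degL F p m n s (φ g) = φ (degL F p m n s g) := by
  let T : ℤ → O F p m n →ₗ[F] O F p m n := fun b =>
    φ.toLinearMap ∘ₗ degL F p m n b - degL F p m n b ∘ₗ φ.toLinearMap
  have hT : ∀ b g, g ∈ LinearMap.ker (T b) ↔ degL F p m n b (φ g) = φ (degL F p m n b g) := by
    intro b g
    simp [T, LinearMap.mem_ker, sub_eq_zero]; exact eq_comm
  have main := gen_induction (F := F) d.hp (⨅ b, LinearMap.ker (T b)) ?_ ?_ g
  · rw [Submodule.mem_iInf] at main
    exact (hT s g).1 (main s)
  · rw [Submodule.mem_iInf]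
    intro b; rw [hT, d.one, deg_one]
    split_ifs
    · rw [d.one]
    · simp
  · intro l g hg
    rw [Submodule.mem_iInf] at hg ⊢
    intro b
    rw [hT, deg_mul_x d.hp, d.mul_x, d.mul_x, map_sum]
    refine Finset.sum_congr rfl fun j _ => ?_
    rw [map_smul, deg_mul_x d.hp, (hT _ g).1 (hg _)]

lemma Dat.symm_x (d : Dat A φ) (k : Fin (m + n)) :
    φ.symm (xVar k) = ∑ i, A i k • xVar i := by
  rw [LinearEquiv.symm_apply_eq, map_sum]
  simp only [map_smul, d.x, Finset.smul_sum, smul_smul]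
  rw [Finset.sum_comm]
  simp only [← Finset.sum_smul]
  have : ∀ j, ∑ i, A i k * A⁻¹ j i = (1 : Matrix _ _ F) j k := by
    intro j
    rw [← Matrix.nonsing_inv_mul A d.hA, Matrix.mul_apply]
    exact Finset.sum_congr rfl fun i _ => mul_comm _ _
  simp only [this]
  rw [Finset.sum_eq_single k]
  · simp
  · intro b _ hb; rw [Matrix.one_apply_ne hb, zero_smul]
  · simp

lemma act_sum (D : W F p m n) {ι : Type*} (s : Finset ι) (c : ι → F) (f : ι → O F p m n) :
    act D (∑ i ∈ s, c i • f i) = ∑ i ∈ s, c i • act D (f i) := by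
  simp only [act, pd_eq, mulO_eq, map_sum, map_smul, Finset.smul_sum]
  rw [Finset.sum_comm]

lemma act_x (hp : 1 < p) (D : W F p m n) (i : Fin (m + n)) : act D (xVar i) = D i := by
  rw [act, Finset.sum_eq_single i]
  · rw [pd_x hp, if_pos rfl, mulO_one]
  · intro b _ hb; rw [pd_x hp, if_neg hb, mulO_eq, map_zero]
  · simp

lemma Dat.Phi (d : Dat A φ) (D : W F p m n) (k : Fin (m + n)) :
    PhiMap φ D k = ∑ i, A i k • φ (D i) := by
  rw [PhiMap, d.symm_x, act_sum, map_sum]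
  simp only [map_smul, act_x d.hp]

/-- `Φ` as a linear map. -/
def phiL (A : Matrix (Fin (m + n)) (Fin (m + n)) F) (φ : O F p m n ≃ₗ[F] O F p m n) :
    W F p m n →ₗ[F] W F p m n where
  toFun D k := ∑ i, A i k • φ (D i)
  map_add' D E := by
    funext k
    simp only [Pi.add_apply, map_add, smul_add, Finset.sum_add_distrib]
  map_smul' c D := by
    funext k
    simp only [Pi.smul_apply, map_smul, RingHom.id_apply, Finset.smul_sum]
    exact Finset.sum_congr rfl fun i _ => smul_comm _ _ _

lemma Dat.PhiL (d : Dat A φ) (D : W F p m n) : PhiMap φ D = phiL A φ D :=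
  funext fun k => d.Phi D k

lemma Dat.act (d : Dat A φ) (D : W F p m n) (g : O F p m n) :
    φ (act D g) = Cartan.act (PhiMap φ D) (φ g) := by
  simp only [Cartan.act, map_sum, d.mul, d.pd, d.Phi]
  simp only [map_sum, mulO_eq, map_smul, LinearMap.sum_apply,
    LinearMap.smul_apply]
  rw [Finset.sum_comm]

lemma Dat.projW (d : Dat A φ) (b : ZMod 2) (D : W F p m n) :
    PhiMap φ (projW b D) = Cartan.projW b (PhiMap φ D) := by
  funext k
  simp only [d.Phi, Cartan.projW]
  rw [proj_eq, map_sum]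
  refine Finset.sum_congr rfl fun i _ => ?_
  by_cases h : parIdx m i = parIdx m k
  · rw [map_smul, ← proj_eq, d.proj, h]
  · rw [d.even i k h]; simp

lemma Dat.act_comp (d : Dat A φ) (D E : W F p m n) :
    PhiMap φ (fun k => Cartan.act D (E k)) =
      fun k => Cartan.act (PhiMap φ D) (PhiMap φ E k) := by
  funext k
  simp only [d.Phi E]
  rw [d.Phi, act_sum]
  simp only [d.act]

lemma Dat.bracket (d : Dat A φ) (D E : W F p m n) :
    PhiMap φ (bracketW D E) = bracketW (PhiMap φ D) (PhiMap φ E) := by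
  unfold bracketW
  rw [d.PhiL]
  simp only [map_sum]
  refine Finset.sum_congr rfl fun a _ => Finset.sum_congr rfl fun b _ => ?_
  have h1 := d.act_comp (Cartan.projW a D) (Cartan.projW b E)
  have h2 := d.act_comp (Cartan.projW b E) (Cartan.projW a D)
  rw [d.projW, d.projW, d.PhiL] at h1 h2
  have : (fun k => Cartan.act (Cartan.projW a D) (Cartan.projW b E k)
      - ((-1 : F)) ^ (a * b).val • Cartan.act (Cartan.projW b E) (Cartan.projW a D k) : W F p m n)
      = (fun k => Cartan.act (Cartan.projW a D) (Cartan.projW b E k))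
      - ((-1 : F)) ^ (a * b).val •
        (fun k => Cartan.act (Cartan.projW b E) (Cartan.projW a D k) : W F p m n) := rfl
  rw [this, map_sub, map_smul, h1, h2]
  rfl

lemma Dat.div (d : Dat A φ) (D : W F p m n) : divW (PhiMap φ D) = φ (divW D) := by
  unfold divW
  simp only [map_sum, map_smul, d.pd, d.Phi, Finset.smul_sum]
  have e : ∀ k b, (-1 : F) ^ (b * parIdx m k).val • Cartan.pd k (projO b (∑ i, A i k • φ (D i)))
      = ∑ i, (-1 : F) ^ (b * parIdx m i).val • A i k • Cartan.pd k (φ (projO b (D i))) := by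
    intro k b
    rw [proj_eq, map_sum, pd_eq, map_sum, Finset.smul_sum]
    refine Finset.sum_congr rfl fun i _ => ?_
    by_cases h : parIdx m i = parIdx m k
    · rw [map_smul, map_smul, ← proj_eq, d.proj, h, pd_eq]
    · rw [d.even i k h]; simp
  simp only [e]
  rw [Finset.sum_comm]
  conv_rhs => rw [Finset.sum_comm]
  refine Finset.sum_congr rfl fun b _ => ?_
  rw [Finset.sum_comm]

lemma Dat.inW (d : Dat A φ) (s : ℤ) (D : W F p m n) (h : inW s D) : Cartan.inW s (PhiMap φ D) := by
  intro k
  rw [inO_iff, d.Phi, map_sum]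
  refine Finset.sum_congr rfl fun i _ => ?_
  rw [map_smul, d.deg, (inO_iff _ _).1 (h i)]

lemma Dat.bij (d : Dat A φ) : Function.Bijective (PhiMap φ) := by
  have hinj : Function.Injective (phiL A φ) := by
    rw [← LinearMap.ker_eq_bot, LinearMap.ker_eq_bot']
    intro D hD
    funext j
    have h : ∀ k, ∑ i, A i k • φ (D i) = 0 := fun k => congrFun hD k
    have h2 : ∑ k, A⁻¹ k j • ∑ i, A i k • φ (D i) = 0 := by simp [h]
    simp only [Finset.smul_sum, smul_smul] at h2
    rw [Finset.sum_comm] at h2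
    simp only [← Finset.sum_smul] at h2
    have : ∀ i, ∑ k, A⁻¹ k j * A i k = (1 : Matrix _ _ F) i j := by
      intro i
      rw [← Matrix.mul_nonsing_inv A d.hA, Matrix.mul_apply]
      exact Finset.sum_congr rfl fun i _ => mul_comm _ _
    simp only [this] at h2
    rw [Finset.sum_eq_single j] at h2
    · simpa using h2
    · intro b _ hb; rw [Matrix.one_apply_ne hb, zero_smul]
    · simp
  have : PhiMap φ = phiL A φ := funext d.PhiL
  rw [this]
  exact ⟨hinj, LinearMap.injective_iff_surjective.1 hinj⟩

lemma Dat.Dij (d : Dat A φ) (i j : Fin (m + n)) (c : ZMod 2) (a : O F p m n) :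
    PhiMap φ (Dij i j c a) = ∑ r, ∑ s, (A i r * A j s) • Cartan.Dij r s c (φ a) := by
  funext k
  rw [d.Phi]
  simp only [Finset.sum_apply, Pi.smul_apply, Cartan.Dij, map_sub, smul_sub,
    Finset.sum_sub_distrib]
  congr 1
  · rw [Finset.sum_eq_single j]
    · rw [if_pos rfl, map_smul, d.pd, Finset.smul_sum, Finset.smul_sum]
      refine Finset.sum_congr rfl fun r _ => ?_
      rw [Finset.sum_eq_single k]
      · rw [if_pos rfl]
        by_cases h : parIdx m i = parIdx m r
        · by_cases h' : parIdx m j = parIdx m k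
          · rw [h, h', smul_smul, smul_smul, smul_smul]; congr 1; ring
          · rw [d.even j k h']; simp
        · rw [d.even i r h]; simp
      · intro b _ hb; rw [if_neg (Ne.symm hb), smul_zero]
      · simp
    · intro b _ hb; simp [hb]
    · simp
  · rw [Finset.sum_eq_single i]
    · rw [if_pos rfl, map_smul, d.pd, Finset.smul_sum, Finset.smul_sum, Finset.sum_comm]
      refine Finset.sum_congr rfl fun r _ => ?_
      rw [Finset.sum_eq_single k]
      · rw [if_pos rfl]
        by_cases h : parIdx m j = parIdx m r
        · by_cases h' : parIdx m i = parIdx m k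
          · rw [h, h', smul_smul, smul_smul, smul_smul]; congr 1; ring
          · rw [d.even i k h']; simp
        · rw [d.even j r h]; simp
      · intro b _ hb; rw [if_neg (Ne.symm hb), smul_zero]
      · simp
    · intro b _ hb; simp [hb]
    · simp

lemma Dat.span (d : Dat A φ) (D : W F p m n) (hD : D ∈ Submodule.span F (SSet F p m n)) :
    PhiMap φ D ∈ Submodule.span F (SSet F p m n) := by
  rw [d.PhiL]
  have : Submodule.span F (SSet F p m n) ≤
      (Submodule.span F (SSet F p m n)).comap (phiL A φ) := by
    rw [Submodule.span_le]
    rintro _ ⟨i, j, c, a, ha, rfl⟩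
    change phiL A φ _ ∈ Submodule.span F (SSet F p m n)
    rw [← d.PhiL, d.Dij]
    refine Submodule.sum_mem _ fun r _ => Submodule.sum_mem _ fun s _ =>
      Submodule.smul_mem _ _ (Submodule.subset_span ⟨r, s, c, φ a, ?_, rfl⟩)
    rw [isParO_iff] at ha ⊢
    rw [← proj_eq] at ha ⊢
    rw [d.proj, ha]
  exact this hD

end Main

/-- for an even invertible matrix `A` and the algebra automorphism `φ`
of `O(m,n)` with `φ(x_i) = ξ_i` where `ξ = x·A⁻¹`, the map `Φ(D) = φ∘D∘φ⁻¹` is a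
`ℤ`-homogeneous Lie superalgebra automorphism of `W(m,n)` satisfying
`div(Φ(D)) = φ(div D)`; consequently `Φ` restricts to an automorphism of `S(m,n)`. -/
theorem Phi_automorphism (F : Type*) [Field F] (p m n : ℕ) [Fact p.Prime] [CharP F p]
    (hp : 3 < p) (hm : 2 ≤ m) (hn : 2 ≤ n)
    (A : Matrix (Fin (m + n)) (Fin (m + n)) F) (hA : IsUnit A.det)
    (heven : ∀ i j : Fin (m + n), parIdx m i ≠ parIdx m j → A i j = 0)
    (φ : O F p m n ≃ₗ[F] O F p m n)
    (hmul : ∀ f g : O F p m n, φ (mulO f g) = mulO (φ f) (φ g))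
    (hone : φ (oneO F p m n) = oneO F p m n)
    (hx : ∀ i : Fin (m + n), φ (xVar i) = ∑ j : Fin (m + n), A⁻¹ j i • xVar j) :
    Function.Bijective (PhiMap φ) ∧
    (∀ D E : W F p m n, PhiMap φ (bracketW D E) = bracketW (PhiMap φ D) (PhiMap φ E)) ∧
    (∀ (s : ℤ) (D : W F p m n), inW s D → inW s (PhiMap φ D)) ∧
    (∀ D : W F p m n, divW (PhiMap φ D) = φ (divW D)) ∧
    (∀ D ∈ Submodule.span F (SSet F p m n),
        PhiMap φ D ∈ Submodule.span F (SSet F p m n)) := by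
  have d : Dat A φ := ⟨by omega, hA, heven, even_inv hA heven, hmul, hone, hx⟩
  exact ⟨d.bij, d.bracket, d.inW, d.div, d.span⟩

end Cartan
end
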